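/- arXiv:2212.10649 — 3 statements merged into one kernel-verified Lean document; each statement's English description precedes it below -/
import Mathlib

section
/- Let G=(N,E) and G'=(N,E') be DAGs on the same node set, with each state space X_s having at least two elements. If P^{G'} ⊇ P^G, E' ⊇ E* (G' contains all edges of G reversed), and G has exactly one root, then there exists a DAG H=(N,E_H) with E_H ⊆ E' such that H is perfect and the skeleton H^∼ contains the moral graph G^M. -/
open Finset

/-! Basic graph-theoretic definitions for Bayesian networks. -/

/-- Two nodes are joined (adjacent) in the directed graph `E`. -/
def GJoined {V : Type*} (E : V → V → Prop) (a b : V) : Prop := E a b ∨ E b a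

/-- A directed graph (given by its edge relation) is a DAG iff it has no cycles:
no node can reach itself by a nonempty directed walk. -/
def IsDAG {V : Type*} (E : V → V → Prop) : Prop := ∀ s, ¬ Relation.TransGen E s s

/-- The set of parents of `s`. -/
def paG {V : Type*} (E : V → V → Prop) (s : V) : Set V := {t | E t s}

/-- The set of children of `s`. -/
def chG {V : Type*} (E : V → V → Prop) (s : V) : Set V := {t | E s t}

/-- The set of descendants of `s` (nodes reachable from `s` by a nonempty directed path). -/
def desG {V : Type*} (E : V → V → Prop) (s : V) : Set V := {t | Relation.TransGen E s t}

/-- A set of nodes is complete if all pairs of distinct elements are joined. -/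
def GComplete {V : Type*} (E : V → V → Prop) (S : Set V) : Prop :=
  ∀ a ∈ S, ∀ b ∈ S, a ≠ b → GJoined E a b

/-- A directed graph is perfect if the parent set of every node is complete. -/
def GPerfect {V : Type*} (E : V → V → Prop) : Prop := ∀ s, GComplete E (paG E s)

/-- `a` and `b` are joined in the moral graph `G^M` of `E`:
either joined in `E` or distinct common parents of some node. -/
def MoralEdge {V : Type*} (E : V → V → Prop) (a b : V) : Prop :=
  E a b ∨ E b a ∨ (a ≠ b ∧ ∃ s, E a s ∧ E b s)

/-- A topological ordering of a graph on a finite node set: an injective map into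
`{1, …, |N|}` (encoded as `Fin (card V)`) increasing along edges. -/
def IsTopo {V : Type*} [Fintype V] (E : V → V → Prop) (O : V → Fin (Fintype.card V)) : Prop :=
  Function.Injective O ∧ ∀ s t, E s t → O s < O t

/-! d-separation. -/

/-- `u` is a v-structure (collider) of the trail `l` in the graph `E`. -/
def VStruct {V : Type*} (E : V → V → Prop) (l : List V) (u : V) : Prop :=
  ∃ l₁ l₂ a b, l = l₁ ++ a :: u :: b :: l₂ ∧ E a u ∧ E b u

/-- `l` is a trail in the graph `E`: a nonempty sequence of distinct nodes consecutively joined. -/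
def IsTrail {V : Type*} (E : V → V → Prop) (l : List V) : Prop :=
  l ≠ [] ∧ l.Nodup ∧ l.Chain' (GJoined E)

/-- The trail `l` is blocked by `S`. -/
def BlockedBy {V : Type*} (E : V → V → Prop) (S : Set V) (l : List V) : Prop :=
  ∃ u ∈ l, (u ∈ S ∧ ¬ VStruct E l u) ∨
    (VStruct E l u ∧ u ∉ S ∧ ∀ t ∈ desG E u, t ∉ S)

/-- d-separation: every trail from a node of `A` to a node of `B` is blocked by `S`. -/
def DSep {V : Type*} (E : V → V → Prop) (A B S : Set V) : Prop :=
  ∀ (l : List V) (a b : V), IsTrail E l → l.head? = some a → l.getLast? = some b →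
    a ∈ A → b ∈ B → BlockedBy E S l

/-- The set of leaves (childless nodes), as a `Finset`. -/
def leavesF {V : Type*} [Fintype V] (E : V → V → Prop) [DecidableRel E] : Finset V :=
  Finset.univ.filter fun s => ∀ t, ¬ E s t

/-! Probability on graphs (finite state spaces, pmfs). -/

section Prob

variable {V : Type*} [Fintype V] [DecidableEq V]
variable (X : V → Type*) [∀ v, Fintype (X v)]

/-- `p` is a probability mass function on `X_N = ∏ v, X v`. -/
def IsPMF (p : (∀ v, X v) → ℝ) : Prop :=
  (∀ x, 0 ≤ p x) ∧ ∑ x, p x = 1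

/-- `k` is a kernel function for the node `s` w.r.t. the graph `E`: it is nonnegative,
depends on the configuration only through the parents of `s` in `E`, and is normalized. -/
def IsKernel (E : V → V → Prop) (s : V) (k : X s → (∀ v, X v) → ℝ) : Prop :=
  (∀ a x, 0 ≤ k a x) ∧
  (∀ a x y, (∀ t, E t s → x t = y t) → k a x = k a y) ∧
  (∀ x, ∑ a, k a x = 1)

/-- `p` factorizes over the graph `E`: it is a product of kernel functions, one per node. -/
def Factorizes (E : V → V → Prop) (p : (∀ v, X v) → ℝ) : Prop :=
  ∃ k : ∀ s, X s → (∀ v, X v) → ℝ,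
    (∀ s, IsKernel X E s (k s)) ∧ ∀ x, p x = ∏ s, k s (x s) x

variable [∀ v, DecidableEq (X v)]

/-- The marginal of `p` on the coordinates in `C`, evaluated at (the `C`-part of) `x`. -/
def marg (p : (∀ v, X v) → ℝ) (C : Finset V) (x : ∀ v, X v) : ℝ :=
  ∑ y, if ∀ v ∈ C, y v = x v then p y else 0

/-- Conditional independence `A ⟂⟂ B ∣ S` w.r.t. the pmf `p`. -/
def CondIndep (p : (∀ v, X v) → ℝ) (A B S : Finset V) : Prop :=
  ∀ x, 0 < marg X p S x →
    marg X p (A ∪ B ∪ S) x * marg X p S x = marg X p (A ∪ S) x * marg X p (B ∪ S) x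

/-- `q` is a conditional system for `N ∖ A` given `A`: a family of pmfs on `X_{N∖A}`,
one for every configuration on `A`.  Here `q x` encodes `q(x_{N∖A} ∣ x_A)`. -/
def IsCondSystem (A : Finset V) (q : (∀ v, X v) → ℝ) : Prop :=
  (∀ x, 0 ≤ q x) ∧ ∀ x : ∀ v, X v, (∑ y, if ∀ v ∈ A, y v = x v then q y else 0) = 1

/-- The conditional system `q` for `N ∖ A` given `A` factorizes over the graph `E`. -/
def CondFactorizes (E : V → V → Prop) (A : Finset V) (q : (∀ v, X v) → ℝ) : Prop :=
  ∃ k : ∀ s, X s → (∀ v, X v) → ℝ,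
    (∀ s ∉ A, IsKernel X E s (k s)) ∧ ∀ x, q x = ∏ s ∈ Finset.univ \ A, k s (x s) x

/-- The conditional system `q` for `N ∖ A` given `A` is a version of the conditional
distribution of the pmf `p`. -/
def IsVersionOf (A : Finset V) (q p : (∀ v, X v) → ℝ) : Prop :=
  ∀ x, p x = q x * marg X p A x

/-- `G'` (edges `E'`) satisfies Goal I for `G` (edges `E`): `roots(G') ⊇ leaves(G)` and for
every pmf factorizing over `G` there is a conditional system for `N ∖ leaves(G)` given
`leaves(G)` factorizing over `G'` which is a version of its conditional distribution. -/
def GoalI (E E' : V → V → Prop) [DecidableRel E] : Prop :=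
  (∀ s ∈ leavesF E, ∀ t, ¬ E' t s) ∧
  ∀ p : (∀ v, X v) → ℝ, IsPMF X p → Factorizes X E p →
    ∃ q, IsCondSystem X (leavesF E) q ∧ CondFactorizes X E' (leavesF E) q ∧
      IsVersionOf X (leavesF E) q p

/-- `G'` (edges `E'`) satisfies Goal II for `G` (edges `E`): `P^{G'} ⊇ P^G` and every parent
in `G'` of a leaf of `G` is itself a leaf of `G`. -/
def GoalII (E E' : V → V → Prop) : Prop :=
  (∀ p : (∀ v, X v) → ℝ, IsPMF X p → Factorizes X E p → Factorizes X E' p) ∧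
  ∀ s t, (∀ u, ¬ E s u) → E' t s → ∀ u, ¬ E t u

end Prob

/-- A finite DAG admits an injective numbering increasing along edges. -/
theorem IsDAG.exists_numbering {V : Type*} [Fintype V] {E : V → V → Prop} (hE : IsDAG E) :
    ∃ O : V → ℕ, Function.Injective O ∧ ∀ a b, E a b → O a < O b := by
  classical
  have : IsPartialOrder V (Relation.ReflTransGen E) :=
    { refl := fun _ => Relation.ReflTransGen.refl
      trans := fun _ _ _ => Relation.ReflTransGen.trans
      antisymm := fun a b hab hba => by
        rcases Relation.reflTransGen_iff_eq_or_transGen.1 hab with h | h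
        · exact h.symm
        · exact (hE a (h.trans_left hba)).elim }
  obtain ⟨r, hr, hle⟩ := extend_partialOrder (Relation.ReflTransGen E)
  have hlt : ∀ a b, r a b → a ≠ b → #{u | r u a} < #{u | r u b} := by
    intro a b hab hne
    refine Finset.card_lt_card ((Finset.ssubset_iff_of_subset ?_).2 ⟨b, ?_, ?_⟩)
    · intro u hu
      simp only [mem_filter, mem_univ, true_and] at hu ⊢
      exact _root_.trans hu hab
    · simpa using refl_of r b
    · simpa using fun hba => hne (antisymm_of r hab hba)
  refine ⟨fun v => #{u | r u v}, ?_, ?_⟩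
  · intro a b hab
    by_contra hne
    rcases total_of r a b with h | h
    · exact (hlt a b h hne).ne hab
    · exact (hlt b a h (Ne.symm hne)).ne hab.symm
  · intro a b hab
    refine hlt a b (hle _ _ (Relation.ReflTransGen.single hab)) ?_
    rintro rfl
    exact hE a (Relation.TransGen.single hab)

section Kernels

variable {V : Type*} [Fintype V] [DecidableEq V] {X : V → Type*} [∀ v, Fintype (X v)]
  {E : V → V → Prop}

/-- Given the values on the nodes numbered below `n`, the kernels of the remaining nodes
multiply to a probability mass function. -/
theorem sum_prod_kernel_tail {O : V → ℕ} (hinj : Function.Injective O)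
    (hO : ∀ a b, E a b → O a < O b) [∀ v, DecidableEq (X v)]
    {k : ∀ s, X s → (∀ v, X v) → ℝ} (hk : ∀ s, IsKernel X E s (k s)) (m : ℕ) :
    ∀ (n : ℕ), (∀ v, O v < n + m) → ∀ z : ∀ v, X v,
      (∑ x : ∀ v, X v, if ∀ v, O v < n → x v = z v then
        ∏ v with n ≤ O v, k v (x v) x else 0) = 1 := by
  induction m with
  | zero =>
    intro n hn z
    have h0 : ({v | n ≤ O v} : Finset V) = ∅ := by
      ext v
      simpa using hn v
    rw [Finset.sum_eq_single z]
    · simp [h0]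
    · intro x _ hx
      rw [if_neg]
      exact fun h => hx (funext fun v => h v (hn v))
    · simp
  | succ m ih =>
    intro n hn z
    have hn' : ∀ v, O v < n + 1 + m := fun v => by have := hn v; omega
    by_cases hw : ∃ w, O w = n
    · obtain ⟨w, hw⟩ := hw
      rw [← (hk w).2.2 z]
      have hsum : ∀ b, k w b z = ∑ x : ∀ v, X v,
          k w b z * if ∀ v, O v < n + 1 → x v = Function.update z w b v then
            ∏ v with n + 1 ≤ O v, k v (x v) x else 0 := fun b => by
        rw [← Finset.mul_sum, ih _ hn', mul_one]
      rw [Finset.sum_congr rfl fun b _ => hsum b, Finset.sum_comm]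
      refine Finset.sum_congr rfl fun x _ => ?_
      have hiff : ∀ b, (∀ v, O v < n + 1 → x v = Function.update z w b v) ↔
          ((∀ v, O v < n → x v = z v) ∧ x w = b) := by
        intro b
        constructor
        · intro h
          refine ⟨fun v hv => ?_, ?_⟩
          · have hvw : v ≠ w := by
              rintro rfl
              omega
            simpa [hvw] using h v (by omega)
          · simpa using h w (by omega)
        · rintro ⟨h, rfl⟩ v hv
          by_cases hvw : v = w
          · subst hvw
            simp
          · have : O v ≠ n := fun h' => hvw (hinj (h'.trans hw.symm))
            simpa [hvw] using h v (by omega)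
      rw [Finset.sum_eq_single (x w)]
      · by_cases hx : ∀ v, O v < n → x v = z v
        · rw [if_pos hx, if_pos ((hiff _).2 ⟨hx, rfl⟩)]
          have hins : ({v | n ≤ O v} : Finset V) = insert w ({v | n + 1 ≤ O v} : Finset V) := by
            ext v
            simp only [mem_filter, mem_univ, true_and, mem_insert]
            constructor
            · intro h
              by_cases hv : O v = n
              · exact Or.inl (hinj (hv.trans hw.symm))
              · right
                omega
            · rintro (rfl | h) <;> omega
          rw [hins, Finset.prod_insert (by simp [hw])]
          congr 1
          exact (hk w).2.1 _ _ _ fun t ht => hx t (hw ▸ hO _ _ ht)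
        · rw [if_neg hx, if_neg fun h => hx ((hiff _).1 h).1, mul_zero]
      · intro b _ hb
        rw [if_neg fun h => hb ((hiff _).1 h).2.symm, mul_zero]
      · simp
    · rw [← ih (n + 1) hn' z]
      have hiff : ∀ v, n + 1 ≤ O v ↔ n ≤ O v := fun v => by
        have : O v ≠ n := fun h => hw ⟨v, h⟩
        omega
      have hiff' : ∀ v, O v < n + 1 ↔ O v < n := fun v => by
        have := hiff v
        omega
      simp only [hiff, hiff']

/-- A product of kernels over a DAG is a probability mass function. -/
theorem isPMF_prod_kernel (hE : IsDAG E) {k : ∀ s, X s → (∀ v, X v) → ℝ}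
    (hk : ∀ s, IsKernel X E s (k s)) (z : ∀ v, X v) :
    IsPMF X fun x => ∏ s, k s (x s) x := by
  classical
  obtain ⟨O, hinj, hO⟩ := hE.exists_numbering
  refine ⟨fun x => Finset.prod_nonneg fun s _ => (hk s).1 _ _, ?_⟩
  have := sum_prod_kernel_tail hinj hO hk (∑ v, (O v + 1)) 0 (fun v => by
    have := Finset.single_le_sum (f := fun v => O v + 1) (fun _ _ => Nat.zero_le _)
      (Finset.mem_univ v)
    omega) z
  simpa using this

/-- Choosing each coordinate uniformly in a nonempty set depending on the parents only gives a
factorizing probability mass function with the expected support. -/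
theorem exists_factorizes_of_support (hE : IsDAG E) (z : ∀ v, X v)
    (T : ∀ v, (∀ u, X u) → Finset (X v)) (hne : ∀ v x, (T v x).Nonempty)
    (hT : ∀ v x y, (∀ t, E t v → x t = y t) → T v x = T v y) :
    ∃ p, IsPMF X p ∧ Factorizes X E p ∧ ∀ x, 0 < p x ↔ ∀ v, x v ∈ T v x := by
  classical
  let k : ∀ s, X s → (∀ v, X v) → ℝ := fun s a x => if a ∈ T s x then (#(T s x) : ℝ)⁻¹ else 0
  have hk : ∀ s, IsKernel X E s (k s) := by
    refine fun s => ⟨fun a x => ?_, fun a x y h => ?_, fun x => ?_⟩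
    · simp only [k]
      split_ifs <;> positivity
    · simp only [k, hT s x y h]
    · have : (#(T s x) : ℝ) ≠ 0 := by exact_mod_cast (hne s x).card_pos.ne'
      simp [k, Finset.sum_ite_mem, this]
  refine ⟨_, isPMF_prod_kernel hE hk z, ⟨k, hk, fun _ => rfl⟩, fun x => ?_⟩
  constructor
  · intro h v
    by_contra hv
    exact h.ne' (Finset.prod_eq_zero (Finset.mem_univ v) (if_neg hv))
  · intro h
    refine Finset.prod_pos fun v _ => ?_
    simp only [k, if_pos (h v)]
    have := (hne v x).card_pos
    positivity

/-- A configuration can be modified from number `n` on so as to make the kernels of the nodes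
numbered from `n` on positive. -/
theorem exists_extension_pos {O : V → ℕ} (hinj : Function.Injective O)
    (hO : ∀ a b, E a b → O a < O b) {k : ∀ s, X s → (∀ v, X v) → ℝ}
    (hk : ∀ s, IsKernel X E s (k s)) (n : ℕ) (z : ∀ v, X v) :
    ∃ y : ∀ v, X v, (∀ v, O v < n → y v = z v) ∧ ∀ v, n ≤ O v → 0 < k v (y v) y := by
  have key : ∀ m, ∃ y : ∀ v, X v, (∀ v, O v < n → y v = z v) ∧
      ∀ v, n ≤ O v → O v < n + m → 0 < k v (y v) y := by
    intro m
    induction m with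
    | zero => exact ⟨z, fun _ _ => rfl, fun v h h' => by omega⟩
    | succ m ih =>
      obtain ⟨y, hy, hpos⟩ := ih
      by_cases hw : ∃ w, O w = n + m
      · obtain ⟨w, hw⟩ := hw
        obtain ⟨b, -, hb⟩ : ∃ b ∈ Finset.univ, 0 < k w b y := by
          apply Finset.exists_lt_of_sum_lt
          simp [(hk w).2.2 y]
        have hupd : ∀ v, O v ≤ n + m → ∀ a, k v a (Function.update y w b) = k v a y := by
          refine fun v hv a => (hk v).2.1 _ _ _ fun t ht => ?_
          have htw : t ≠ w := by
            rintro rfl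
            have := hO _ _ ht
            omega
          simp [htw]
        refine ⟨Function.update y w b, fun v hv => ?_, fun v hv hv' => ?_⟩
        · have hvw : v ≠ w := by
            rintro rfl
            omega
          simpa [hvw] using hy v hv
        · rw [hupd v (by omega)]
          by_cases hvw : v = w
          · subst hvw
            simpa using hb
          · have : O v ≠ n + m := fun h => hvw (hinj (h.trans hw.symm))
            simpa [hvw] using hpos v hv (by omega)
      · refine ⟨y, hy, fun v hv hv' => hpos v hv ?_⟩
        have : O v ≠ n + m := fun h => hw ⟨v, h⟩
        omega
  obtain ⟨y, hy, hpos⟩ := key (∑ v, (O v + 1))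
  refine ⟨y, hy, fun v hv => hpos v hv ?_⟩
  have := Finset.single_le_sum (f := fun v => O v + 1) (fun _ _ => Nat.zero_le _)
    (Finset.mem_univ v)
  omega

/-- If `a` precedes `s` and is not a parent of `s`, then the possible values of the `s`-coordinate
given all preceding coordinates do not depend on the `a`-coordinate. -/
theorem Factorizes.exists_pos_of_not_edge {O : V → ℕ} (hinj : Function.Injective O)
    (hO : ∀ a b, E a b → O a < O b) {p : (∀ v, X v) → ℝ} (hp : Factorizes X E p)
    {a s : V} (has : ¬ E a s) {x y : ∀ v, X v} (hx : 0 < p x) (hy : 0 < p y)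
    (hxy : ∀ v, O v < O s → v ≠ a → x v = y v) :
    ∃ z, 0 < p z ∧ (∀ v, O v < O s → z v = y v) ∧ z s = x s := by
  obtain ⟨k, hk, hpk⟩ := hp
  have hpos : ∀ x, 0 < p x → ∀ v, 0 < k v (x v) x := fun x hx v =>
    ((hk v).1 _ _).lt_of_ne' fun h =>
      hx.ne' ((hpk x).trans (Finset.prod_eq_zero (Finset.mem_univ v) h))
  obtain ⟨z, hz, hzpos⟩ := exists_extension_pos hinj hO hk (O s + 1) (Function.update y s (x s))
  have hzy : ∀ v, O v < O s → z v = y v := fun v hv => by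
    have hvs : v ≠ s := by
      rintro rfl
      omega
    simpa [hvs] using hz v (by omega)
  have hzs : z s = x s := by simpa using hz s (by omega)
  refine ⟨z, ?_, hzy, hzs⟩
  rw [hpk]
  refine Finset.prod_pos fun v _ => ?_
  rcases lt_trichotomy (O v) (O s) with hv | hv | hv
  · rw [hzy v hv, (hk v).2.1 _ z y fun t ht => hzy t ((hO _ _ ht).trans hv)]
    exact hpos y hy v
  · obtain rfl := hinj hv
    rw [hzs, (hk v).2.1 _ z x fun t ht => ?_]
    · exact hpos x hx v
    · have hta : t ≠ a := by
        rintro rfl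
        exact has ht
      rw [hzy t (hO _ _ ht), hxy t (hO _ _ ht) hta]
  · exact hzpos v hv

/-- If every distribution factorizing over the single-rooted DAG `E` factorizes over `E'`, and
`E'` contains all the reversed edges of `E`, then `a` is a parent of `s` in `E'` as soon as it
precedes `s` and is a child, or a parent of a child, of some node `t` not preceding `s`. -/
theorem edge_of_factorizes_imp (h2 : ∀ v, 1 < Fintype.card (X v)) {E' : V → V → Prop}
    (hE : IsDAG E)
    (hPP : ∀ p : (∀ v, X v) → ℝ, IsPMF X p → Factorizes X E p → Factorizes X E' p)
    (hrev : ∀ s t, E s t → E' t s) (hroot : ∃! r : V, ∀ t, ¬ E t r)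
    {O : V → ℕ} (hinj : Function.Injective O) (hO : ∀ a b, E' a b → O a < O b)
    {a s t : V} (has : O a < O s) (hst : O s ≤ O t) (ht : E t a ∨ ∃ c, E t c ∧ E a c) :
    E' a s := by
  classical
  by_contra hne
  obtain ⟨r, hr, hr'⟩ := hroot
  have hpar : ∀ v, v ≠ r → ∃ u, E u v := by
    intro v hv
    by_contra! h
    exact hv (hr' v h)
  have hOE : ∀ u v, E u v → O v < O u := fun u v h => hO _ _ (hrev _ _ h)
  choose! par hpar using hpar
  have hβ : ∀ v, ∃ β : Bool → X v, Function.Injective β := fun v => by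
    obtain ⟨b, c, hbc⟩ := Fintype.one_lt_card_iff.1 (h2 v)
    refine ⟨fun i => bif i then b else c, fun i j hij => ?_⟩
    cases i <;> cases j <;> simp_all [eq_comm]
  choose β hβ using hβ
  let d : V → (∀ v, X v) → Bool := fun v x => decide (x v = β v true)
  have hd : ∀ v x i, x v = β v i → d v x = i := by
    intro v x i h
    cases i <;> simp [d, h, (hβ v).eq_iff]
  have hdcongr : ∀ v x y, x v = y v → d v x = d v y := by
    intro v x y h
    simp [d, h]
  -- the configurations equal to `i` at `a` and from `s` on, and to `false` elsewhere
  let y : Bool → ∀ v, X v := fun i v => β v (bif decide (O s ≤ O v ∨ v = a) then i else false)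
  have hy_late : ∀ i v, O s ≤ O v → y i v = β v i := fun i v hv => by simp [y, hv]
  have hya : ∀ i, y i a = β a i := fun i => by simp [y]
  have hy_early : ∀ i v, O v < O s → v ≠ a → y i v = β v false := fun i v hv hva => by
    simp [y, hva, hv.not_ge]
  obtain ⟨h, hhne, hh, hhy, hhz⟩ : ∃ h : ∀ v, (∀ u, X u) → Finset (X v),
      (∀ v x, (h v x).Nonempty) ∧
      (∀ v x y, (∀ t, E t v → x t = y t) → h v x = h v y) ∧
      (∀ i v, O v < O s → y i v ∈ h v (y i)) ∧
      ∀ z, (∀ v, v ≠ r → O v < O s → z v ∈ h v z) → (∀ v, O v < O s → z v = y true v) →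
        d t z = true := by
    rcases ht with ht | ⟨c, htc, hac⟩
    · refine ⟨fun v x => if v = a then {β v (d t x)} else {β v false}, ?_, ?_, ?_, ?_⟩
      · intro v x
        dsimp only
        split_ifs <;> simp
      · intro v x x' hxy
        by_cases hv : v = a
        · subst hv
          simp only [hdcongr t x x' (hxy t ht)]
        · simp only [if_neg hv]
      · intro i v hv
        by_cases hva : v = a
        · subst hva
          simp [hya, hd t (y i) i (hy_late i t hst)]
        · simp [hva, hy_early i v hv hva]
      · intro z hz hzy
        have har : a ≠ r := by
          rintro rfl
          exact hr t ht
        have h1 := hz a har has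
        rw [hzy a has, hya] at h1
        simp only [if_true, mem_singleton] at h1
        exact (hβ a h1).symm
    · have hca := hOE _ _ hac
      have hca' : c ≠ a := by
        rintro rfl
        omega
      refine ⟨fun v x => if v = a then univ else
        if v = c then {β v (xor (d t x) (d a x))} else {β v false}, ?_, ?_, ?_, ?_⟩
      · intro v x
        dsimp only
        split_ifs <;> simp [Nonempty.intro (x v)]
      · intro v x x' hxy
        by_cases hv : v = c
        · subst hv
          simp only [hdcongr t x x' (hxy t htc), hdcongr a x x' (hxy a hac)]
        · simp only [if_neg hv]
      · intro i v hv
        by_cases hva : v = a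
        · simp [hva]
        · by_cases hvc : v = c
          · subst hvc
            simp [hva, hy_early i v hv hva, hd t (y i) i (hy_late i t hst),
              hd a (y i) i (hya i)]
          · simp [hva, hvc, hy_early i v hv hva]
      · intro z hz hzy
        have hcr : c ≠ r := by
          rintro rfl
          exact hr t htc
        have h1 := hz c hcr (hca.trans has)
        rw [hzy c (hca.trans has), hy_early true c (hca.trans has) hca'] at h1
        have h3 : d a z = true := hd a z true (by rw [hzy a has, hya])
        simp only [if_neg hca', if_true, mem_singleton, h3] at h1
        simpa using (hβ c h1).symm
  obtain ⟨p, hp, hpE, hpos⟩ := exists_factorizes_of_support hE (y false)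
    (fun v x => if v = r then univ else
      if O s ≤ O v then {β v (d (par v) x)} else h v x)
    (by
      intro v x
      split_ifs
      · exact ⟨x v, Finset.mem_univ _⟩
      · simp
      · exact hhne v x)
    (by
      intro v x x' hxy
      by_cases hv : v = r
      · simp only [if_pos hv]
      · simp only [if_neg hv, hh v x x' hxy, hdcongr _ x x' (hxy _ (hpar v hv))])
  have hpy : ∀ i, 0 < p (y i) := by
    refine fun i => (hpos _).2 fun v => ?_
    by_cases hvr : v = r
    · simp [hvr]
    · by_cases hv : O s ≤ O v
      · have := hd (par v) (y i) i (hy_late i _ (hv.trans (hOE _ _ (hpar v hvr)).le))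
        simp [hvr, hv, this, hy_late i v hv]
      · simpa [hvr, hv] using hhy i v (not_le.1 hv)
  obtain ⟨z, hz, hzy, hzs⟩ := (hPP p hp hpE).exists_pos_of_not_edge hinj hO hne
    (hpy false) (hpy true) fun v hv hva => by
      rw [hy_early _ v hv hva, hy_early _ v hv hva]
  have hz := (hpos z).1 hz
  obtain ⟨Q, -, hQ⟩ := hE.exists_numbering
  have hconst : ∀ n v, Q v = n → O s ≤ O v → d v z = d r z := by
    intro n
    induction n using Nat.strong_induction_on with
    | _ n ih =>
      intro v hn hv
      by_cases hvr : v = r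
      · rw [hvr]
      · have h1 := hz v
        simp only [if_neg hvr, if_pos hv, mem_singleton] at h1
        rw [hd v z _ h1]
        exact ih _ (hn ▸ hQ _ _ (hpar v hvr)) _ rfl (hv.trans (hOE _ _ (hpar v hvr)).le)
  have hdt : d t z = true := hhz z (fun v hvr hv => by
    simpa [hvr, hv.not_ge] using hz v) hzy
  have hds : d s z = false := hd s z false (by rw [hzs, hy_late false s le_rfl])
  rw [hconst _ t rfl hst] at hdt
  rw [hconst _ s rfl le_rfl, hdt] at hds
  exact Bool.noConfusion hds

end Kernels

/-- if `P^{G'} ⊇ P^G`, `G' ⊇ G*` and `G` has exactly one root, then `G'`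
contains a perfect subgraph `H` whose skeleton contains the moral graph of `G`. -/
theorem stmt12 {V : Type*} [Fintype V] [DecidableEq V] [Nonempty V]
    (X : V → Type*) [∀ v, Fintype (X v)] (h2 : ∀ v, 1 < Fintype.card (X v))
    (E E' : V → V → Prop) (hE : IsDAG E) (hE' : IsDAG E')
    (hPP : ∀ p : (∀ v, X v) → ℝ, IsPMF X p → Factorizes X E p → Factorizes X E' p)
    (hrev : ∀ s t, E s t → E' t s)
    (hroot : ∃! r : V, ∀ t, ¬ E t r) :
    ∃ F : V → V → Prop, (∀ a b, F a b → E' a b) ∧ IsDAG F ∧ GPerfect F ∧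
      ∀ a b, MoralEdge E a b → GJoined F a b := by
  classical
  obtain ⟨O, hinj, hO⟩ := hE'.exists_numbering
  have hOE : ∀ u v, E u v → O v < O u := fun u v h => hO _ _ (hrev _ _ h)
  refine ⟨fun a s => O a < O s ∧ ∃ t, O s ≤ O t ∧ (E t a ∨ ∃ c, E t c ∧ E a c), ?_, ?_, ?_, ?_⟩
  · rintro a s ⟨has, t, hst, ht⟩
    exact edge_of_factorizes_imp h2 hE hPP hrev hroot hinj hO has hst ht
  · have hlt : ∀ a b, Relation.TransGen
        (fun a s => O a < O s ∧ ∃ t, O s ≤ O t ∧ (E t a ∨ ∃ c, E t c ∧ E a c)) a b →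
        O a < O b := by
      intro a b h
      induction h with
      | single h => exact h.1
      | tail _ h ih => exact ih.trans h.1
    exact fun s h => (hlt s s h).false
  · rintro s a ⟨has, t, hst, ht⟩ b ⟨hbs, u, hsu, hu⟩ hab
    rcases lt_or_gt_of_ne (hinj.ne hab) with h | h
    · exact Or.inl ⟨h, t, hbs.le.trans hst, ht⟩
    · exact Or.inr ⟨h, u, has.le.trans hsu, hu⟩
  · rintro a b (h | h | ⟨hab, c, hac, hbc⟩)
    · exact Or.inr ⟨hOE _ _ h, a, le_rfl, Or.inl h⟩
    · exact Or.inl ⟨hOE _ _ h, b, le_rfl, Or.inl h⟩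
    · rcases lt_or_gt_of_ne (hinj.ne hab) with h | h
      · exact Or.inl ⟨h, b, le_rfl, Or.inr ⟨c, hbc, hac⟩⟩
      · exact Or.inr ⟨h, a, le_rfl, Or.inr ⟨c, hac, hbc⟩⟩
end

section
/- Let G=(N,E_G) and H=(N,E_H) be DAGs on the same node set, with each state space X_s having at least two elements, and let A ⊆ N. If P^G ⊆ P^H (for pmfs on X_N), then P^{G[A]} ⊆ P^{H[A]} (for pmfs on X_A), where G[A] and H[A] are the vertex-induced subgraphs on A. -/
open Finset

/-- In a DAG, every nonempty finite set of nodes contains one without children in the set. -/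
lemma IsDAG.exists_sink {V : Type*} {E : V → V → Prop} (hE : IsDAG E) (S : Finset V)
    (hS : S.Nonempty) : ∃ s ∈ S, ∀ t ∈ S, ¬ E s t := by
  have : IsStrictOrder V (Relation.TransGen (Function.swap E)) :=
    { irrefl := fun s h => hE s (by rwa [Relation.transGen_swap] at h)
      trans := fun _ _ _ => Relation.TransGen.trans }
  obtain ⟨⟨s, hs⟩, -, hmin⟩ :=
    (S.finite_toSet.wellFoundedOn (r := Relation.TransGen (Function.swap E))).has_min
      Set.univ ⟨⟨hS.choose, hS.choose_spec⟩, trivial⟩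
  exact ⟨s, hs, fun t ht hst => hmin ⟨t, ht⟩ trivial (.single hst)⟩

open Classical in
/-- Summing a product of kernels over the coordinates in `S`, with the other coordinates fixed,
gives one. -/
lemma sum_prod_kernel_of_fixed {V : Type*} [Fintype V] [DecidableEq V] (X : V → Type*)
    [∀ v, Fintype (X v)] {E : V → V → Prop} (hE : IsDAG E)
    {k : ∀ s, X s → (∀ v, X v) → ℝ} (hk : ∀ s, IsKernel X E s (k s)) (x₀ : ∀ v, X v)
    (S : Finset V) :
    ∑ x with ∀ v ∉ S, x v = x₀ v, ∏ s ∈ S, k s (x s) x = 1 := by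
  induction hn : S.card generalizing S with
  | zero =>
    obtain rfl := Finset.card_eq_zero.1 hn
    have : (univ.filter fun x : ∀ v, X v => ∀ v ∉ (∅ : Finset V), x v = x₀ v) = {x₀} := by
      ext x; simp [funext_iff]
    rw [this, Finset.sum_singleton, Finset.prod_empty]
  | succ n ih =>
    obtain ⟨s, hs, hsink⟩ := hE.exists_sink S (Finset.card_pos.1 (by omega))
    rw [← ih (S.erase s) (by rw [Finset.card_erase_of_mem hs, hn]; rfl)]
    have split : ∑ x with ∀ v ∉ S, x v = x₀ v, ∏ t ∈ S, k t (x t) x =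
        ∑ ya ∈ (univ.filter fun y : ∀ v, X v => ∀ v ∉ S.erase s, y v = x₀ v) ×ˢ
            (univ : Finset (X s)),
          ∏ t ∈ S, k t (Function.update ya.1 s ya.2 t) (Function.update ya.1 s ya.2) := by
      refine Finset.sum_nbij' (fun x => (Function.update x s (x₀ s), x s))
        (fun ya => Function.update ya.1 s ya.2) ?_ ?_ ?_ ?_ ?_
      · intro x hx
        simp only [mem_filter, mem_univ, true_and, mem_product, mem_erase, and_true] at hx ⊢
        intro v hv
        by_cases h : v = s
        · subst h; simp
        · rw [Function.update_of_ne h]; exact hx v fun hvS => hv ⟨h, hvS⟩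
      · rintro ⟨y, a⟩ hy
        simp only [mem_filter, mem_univ, true_and, mem_product, mem_erase, and_true] at hy ⊢
        intro v hv
        have h : v ≠ s := by rintro rfl; exact hv hs
        rw [Function.update_of_ne h]; exact hy v fun hvS => hv hvS.2
      · intro x _; simp
      · rintro ⟨y, a⟩ hy
        simp only [mem_filter, mem_univ, true_and, mem_product, and_true] at hy
        simp [← hy s (by simp)]
      · intro x _; simp
    rw [split, Finset.sum_product]
    refine Finset.sum_congr rfl fun y _ => ?_
    have key (a : X s) :
        ∏ t ∈ S, k t (Function.update y s a t) (Function.update y s a) =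
          k s a y * ∏ t ∈ S.erase s, k t (y t) y := by
      have agree (t : V) (ht : t ∈ S) (b : X t) : k t b (Function.update y s a) = k t b y :=
        (hk t).2.1 _ _ _ fun u hu => Function.update_of_ne
          (by rintro rfl; exact hsink t ht hu) _ _
      rw [← Finset.mul_prod_erase S _ hs, agree s hs, Function.update_self]
      congr 1
      refine Finset.prod_congr rfl fun t ht => ?_
      rw [agree t (Finset.mem_of_mem_erase ht), Function.update_of_ne (Finset.ne_of_mem_erase ht)]
    simp_rw [key]
    rw [← Finset.sum_mul, (hk s).2.2, one_mul]

/-- A product of kernels over a DAG is normalized. -/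
lemma sum_prod_kernel {V : Type*} [Fintype V] [DecidableEq V] (X : V → Type*)
    [∀ v, Fintype (X v)] [∀ v, Nonempty (X v)] {E : V → V → Prop} (hE : IsDAG E)
    {k : ∀ s, X s → (∀ v, X v) → ℝ} (hk : ∀ s, IsKernel X E s (k s)) :
    ∑ x, ∏ s, k s (x s) x = 1 := by
  simpa using sum_prod_kernel_of_fixed X hE hk (fun _ => Classical.arbitrary _) univ

lemma IsKernel.le_one {V : Type*} {X : V → Type*} [∀ v, Fintype (X v)]
    {E : V → V → Prop} {s : V} {k : X s → (∀ v, X v) → ℝ} (hk : IsKernel X E s k)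
    (a : X s) (x : ∀ v, X v) : k a x ≤ 1 :=
  (Finset.single_le_sum (fun b _ => hk.1 b x) (mem_univ a)).trans_eq (hk.2.2 x)

/-- Extend a configuration on `A` by the values of `x₀` outside `A`. -/
def extendConfig {V : Type*} [DecidableEq V] {X : V → Type*} (A : Finset V) (x₀ : ∀ v, X v)
    (y : ∀ a : A, X a.1) (v : V) : X v :=
  if h : v ∈ A then y ⟨v, h⟩ else x₀ v

section extendConfig

variable {V : Type*} [DecidableEq V] {X : V → Type*} {A : Finset V} (x₀ : ∀ v, X v)

lemma extendConfig_mem (y : ∀ a : A, X a.1) {v : V} (h : v ∈ A) :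
    extendConfig A x₀ y v = y ⟨v, h⟩ := dif_pos h

lemma extendConfig_not_mem (y : ∀ a : A, X a.1) {v : V} (h : v ∉ A) :
    extendConfig A x₀ y v = x₀ v := dif_neg h

lemma extendConfig_injective :
    Function.Injective (extendConfig A x₀ : (∀ a : A, X a.1) → ∀ v, X v) := by
  intro y z h
  ext a
  simpa [extendConfig] using congrFun h a.1

end extendConfig

open Classical in
/-- The product of `p` with the point mass at `x₀` outside `A`. -/
noncomputable def extendPMF {V : Type*} {X : V → Type*} (A : Finset V)
    (x₀ : ∀ v, X v) (p : (∀ a : A, X a.1) → ℝ) (x : ∀ v, X v) : ℝ :=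
  if ∀ v ∉ A, x v = x₀ v then p (fun a => x a.1) else 0

lemma extendPMF_extendConfig {V : Type*} [DecidableEq V] {X : V → Type*} {A : Finset V}
    (x₀ : ∀ v, X v) {p : (∀ a : A, X a.1) → ℝ} (y : ∀ a : A, X a.1) :
    extendPMF A x₀ p (extendConfig A x₀ y) = p y := by
  rw [extendPMF, if_pos fun v hv => extendConfig_not_mem x₀ y hv]
  congr 1
  ext a
  exact extendConfig_mem x₀ y a.2

section extendPMF

variable {V : Type*} [Fintype V] [DecidableEq V] {X : V → Type*}
  [∀ v, Fintype (X v)] {A : Finset V} (x₀ : ∀ v, X v) {p : (∀ a : A, X a.1) → ℝ}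

lemma isPMF_extendPMF (hp : IsPMF (fun a : A => X a.1) p) : IsPMF X (extendPMF A x₀ p) := by
  refine ⟨fun x => ?_, ?_⟩
  · unfold extendPMF
    split_ifs
    exacts [hp.1 _, le_rfl]
  · rw [← hp.2]
    symm
    refine Finset.sum_of_injOn (extendConfig A x₀) (extendConfig_injective x₀).injOn
      (fun _ _ => by simp) (fun x _ hx => ?_) fun y _ => (extendPMF_extendConfig x₀ y).symm
    refine if_neg fun h => hx ⟨fun a => x a.1, by simp, ?_⟩
    ext v
    by_cases hv : v ∈ A
    · rw [extendConfig_mem x₀ _ hv]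
    · rw [extendConfig_not_mem x₀ _ hv, h v hv]

lemma factorizes_extendPMF {E : V → V → Prop}
    (hp : Factorizes (fun a : A => X a.1) (fun a b : A => E a.1 b.1) p) :
    Factorizes X E (extendPMF A x₀ p) := by
  classical
  obtain ⟨k, hk, hpk⟩ := hp
  refine ⟨fun s a x => if h : s ∈ A then k ⟨s, h⟩ a (fun b => x b.1)
    else if a = x₀ s then 1 else 0, fun s => ?_, fun x => ?_⟩
  · by_cases hs : s ∈ A
    · simp only [hs, dif_pos]
      exact ⟨fun a x => (hk _).1 _ _, fun a x y h => (hk _).2.1 _ _ _ fun t ht => h _ ht,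
        fun x => (hk ⟨s, hs⟩).2.2 _⟩
    · simp only [hs, dif_neg, not_false_eq_true]
      exact ⟨fun a _ => by dsimp only; split_ifs <;> norm_num, fun _ _ _ _ => rfl, fun _ => by simp⟩
  · rw [← Finset.prod_mul_prod_compl A, ← Finset.prod_coe_sort A]
    have h₁ : ∏ s : A, (if h : s.1 ∈ A then k ⟨s.1, h⟩ (x s.1) (fun b => x b.1)
        else if x s.1 = x₀ s.1 then 1 else 0) = p (fun a => x a.1) := by
      rw [hpk]
      exact Finset.prod_congr rfl fun s _ => dif_pos s.2
    dsimp only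
    rw [h₁, extendPMF]
    split_ifs with h
    · rw [Finset.prod_eq_one, mul_one]
      intro s hs
      rw [Finset.mem_compl] at hs
      simp [hs, h s hs]
    · push Not at h
      obtain ⟨s, hs, hne⟩ := h
      rw [Finset.prod_eq_zero (Finset.mem_compl.2 hs) (by simp [hs, hne]), mul_zero]

end extendPMF

/-- if `P^G ⊆ P^H` then `P^{G[A]} ⊆ P^{H[A]}` for the vertex-induced
subgraphs on any `A ⊆ N`. -/
theorem stmt14 {V : Type*} [Fintype V] [DecidableEq V] [Nonempty V]
    (X : V → Type*) [∀ v, Fintype (X v)] (h2 : ∀ v, 1 < Fintype.card (X v))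
    (EG EH : V → V → Prop) (hG : IsDAG EG) (hH : IsDAG EH)
    (hsub : ∀ p : (∀ v, X v) → ℝ, IsPMF X p → Factorizes X EG p → Factorizes X EH p)
    (A : Finset V) :
    ∀ p : (∀ a : A, X a.1) → ℝ, IsPMF (fun a : A => X a.1) p →
      Factorizes (fun a : A => X a.1) (fun a b : A => EG a.1 b.1) p →
      Factorizes (fun a : A => X a.1) (fun a b : A => EH a.1 b.1) p := by
  intro p hp hpG
  have (v : V) : Nonempty (X v) := Fintype.card_pos_iff.1 (by have := h2 v; omega)
  let x₀ : ∀ v, X v := fun _ => Classical.arbitrary _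
  obtain ⟨k, hk, hpk⟩ := hsub _ (isPMF_extendPMF x₀ hp) (factorizes_extendPMF x₀ hpG)
  let κ : ∀ s : A, X s.1 → (∀ a : A, X a.1) → ℝ := fun s a y => k s.1 a (extendConfig A x₀ y)
  have hκ (s : A) :
      IsKernel (fun a : A => X a.1) (fun a b : A => EH a.1 b.1) s (κ s) := by
    refine ⟨fun a x => (hk _).1 _ _, fun a x y h => (hk _).2.1 _ _ _ fun t ht => ?_,
      fun x => (hk _).2.2 _⟩
    by_cases hA : t ∈ A
    · rw [extendConfig_mem x₀ _ hA, extendConfig_mem x₀ _ hA]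
      exact h ⟨t, hA⟩ ht
    · rw [extendConfig_not_mem x₀ _ hA, extendConfig_not_mem x₀ _ hA]
  have hdag : IsDAG (fun a b : A => EH a.1 b.1) := fun s hs =>
    hH s.1 (Relation.TransGen.lift Subtype.val (fun _ _ h => h) s s hs)
  have hle (y : ∀ a : A, X a.1) : p y ≤ ∏ s, κ s (y s) y := by
    rw [← extendPMF_extendConfig x₀ (p := p) y, hpk,
      ← Finset.prod_mul_prod_compl A, ← Finset.prod_coe_sort A]
    have h₁ : ∏ s : A, k s.1 (extendConfig A x₀ y s.1) (extendConfig A x₀ y) =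
        ∏ s, κ s (y s) y :=
      Finset.prod_congr rfl fun s _ => by rw [extendConfig_mem x₀ y s.2]
    rw [h₁]
    exact mul_le_of_le_one_right (Finset.prod_nonneg fun s _ => (hκ s).1 _ _)
      (Finset.prod_le_one (fun s _ => (hk _).1 _ _) fun s _ => (hk _).le_one _ _)
  refine ⟨κ, hκ, fun y => ?_⟩
  have hsum : ∑ y, p y = ∑ y, ∏ s, κ s (y s) y :=
    hp.2.trans (sum_prod_kernel _ hdag hκ).symm
  exact (Finset.sum_eq_sum_iff_of_le fun y _ => hle y).1 hsum y (mem_univ y)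
end

section
/- Let G=(N,E) be a DAG with each state space X_s having at least two elements, and let G*=(N,E*) be the graph obtained by reversing all edges of G. Then P^G = P^{G*} if and only if for every s ∈ N both pa_G(s) and ch_G(s) are complete. -/
open Finset

theorem exists_strictMono_height {V : Type*} [Fintype V] {E : V → V → Prop} (hE : IsDAG E) :
    ∃ O : V → ℕ, ∀ s t, E s t → O s < O t := by
  classical
  refine ⟨fun v => #{u | Relation.TransGen E u v}, fun s t h => card_lt_card ?_⟩
  refine (ssubset_iff_of_subset fun u hu => ?_).2 ⟨s, ?_, ?_⟩
  · simp only [mem_filter, mem_univ, true_and] at hu ⊢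
    exact hu.tail h
  · simpa using Relation.TransGen.single h
  · simpa using hE s

theorem IsDAG.reverse {V : Type*} {E : V → V → Prop} (hE : IsDAG E) :
    IsDAG fun a b => E b a := fun s h => hE s (Relation.transGen_swap.1 h)

section Kernels

variable {V : Type*} {X : V → Type*} [∀ v, Fintype (X v)]

theorem IsKernel.mono {E E' : V → V → Prop} {s : V} {k : X s → (∀ v, X v) → ℝ}
    (hk : IsKernel X E s k) (h : ∀ t, E t s → E' t s) : IsKernel X E' s k :=
  ⟨hk.1, fun a x y hxy => hk.2.1 a x y fun t ht => hxy t (h t ht), hk.2.2⟩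

theorem sum_sum_update [Fintype V] [DecidableEq V] (F : (∀ v, X v) → ℝ) (r : V) :
    ∑ x, ∑ α, F (Function.update x r α) = Fintype.card (X r) * ∑ x, F x := by
  have h : ∑ q : (∀ v, X v) × X r, F (Function.update q.1 r q.2) =
      ∑ q : (∀ v, X v) × X r, F q.1 :=
    sum_nbij' (fun q => (Function.update q.1 r q.2, q.1 r))
      (fun q => (Function.update q.1 r q.2, q.1 r))
      (by simp) (by simp) (by simp) (by simp) (by simp)
  rw [Fintype.sum_prod_type, Fintype.sum_prod_type] at h
  rw [h]
  simp [mul_sum]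

/-- The product of kernels along a DAG has total mass one. -/
theorem sum_prod_kernel_eq_one [Fintype V] [DecidableEq V] [∀ v, Nonempty (X v)]
    {E : V → V → Prop} (hE : IsDAG E)
    {k : ∀ s, X s → (∀ v, X v) → ℝ} (hk : ∀ s, IsKernel X E s (k s)) :
    ∑ x, ∏ s, k s (x s) x = 1 := by
  obtain ⟨O, hO⟩ := exists_strictMono_height hE
  have key : ∀ S : Finset V, (∏ s ∈ S, (Fintype.card (X s) : ℝ)) * ∑ x, ∏ s ∈ S, k s (x s) x =
      Fintype.card (∀ v, X v) := by
    intro S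
    induction S using Finset.induction_on_max_value O with
    | empty => simp
    | insert r S hr hmax ih =>
      rw [prod_insert hr, mul_right_comm, ← sum_sum_update, mul_comm, ← ih]
      congr 1
      refine sum_congr rfl fun x _ => ?_
      have hnot : ∀ s ∈ insert r S, ¬ E r s := by
        intro s hs h
        have h1 := hO _ _ h
        rcases mem_insert.1 hs with rfl | hs
        · omega
        · have := hmax s hs
          omega
      have hupd : ∀ s ∈ insert r S, ∀ (a : X s) (α : X r),
          k s a (Function.update x r α) = k s a x := fun s hs a α =>
        (hk s).2.1 a _ _ fun t ht => Function.update_of_ne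
          (by rintro rfl; exact hnot s hs ht) _ _
      have hS : ∀ α : X r, ∏ s ∈ insert r S, k s (Function.update x r α s)
          (Function.update x r α) = k r α x * ∏ s ∈ S, k s (x s) x := by
        intro α
        rw [prod_insert hr, hupd r (mem_insert_self _ _), Function.update_self]
        congr 1
        refine prod_congr rfl fun s hs => ?_
        rw [hupd s (mem_insert_of_mem hs), Function.update_of_ne]
        rintro rfl
        exact hr hs
      rw [sum_congr rfl fun α _ => hS α, ← sum_mul, (hk r).2.2, one_mul]
  have h := key univ
  rw [Fintype.card_pi, Nat.cast_prod] at h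
  refine mul_left_cancel₀ (prod_ne_zero_iff.2 fun s _ => ?_) (h.trans (mul_one _).symm)
  exact_mod_cast Fintype.card_ne_zero

/-- The chain rule: a nonnegative function of the coordinates in `T` is, up to a constant,
a product of kernels in which every node depends on the other nodes of at least its height. -/
theorem exists_chain_rule [DecidableEq V] [∀ v, Nonempty (X v)] (O : V → ℕ) (T : Finset V) :
    ∀ f : (∀ v, X v) → ℝ, (∀ x, 0 ≤ f x) → (∀ x y, (∀ t ∈ T, x t = y t) → f x = f y) →
    ∃ (Z : ℝ) (m : ∀ s, X s → (∀ v, X v) → ℝ),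
      (∀ u ∈ T, IsKernel X (fun t u => t ∈ T ∧ t ≠ u ∧ O u ≤ O t) u (m u)) ∧
      ∀ x, f x = Z * ∏ u ∈ T, m u (x u) x := by
  induction T using Finset.induction_on_min_value O with
  | empty =>
    intro f _ hf
    exact ⟨f fun v => Classical.arbitrary _, fun _ _ _ => 0, by simp,
      fun x => by simpa using hf _ _ (by simp)⟩
  | insert a T ha hmin ih =>
    intro f hf0 hf
    have hfu : ∀ (α : X a) x y, (∀ t ∈ T, x t = y t) →
        f (Function.update x a α) = f (Function.update y a α) := by
      intro α x y hxy
      refine hf _ _ fun t ht => ?_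
      by_cases h : t = a
      · subst h; simp
      · simpa [h] using hxy t (mem_of_mem_insert_of_ne ht h)
    set g : (∀ v, X v) → ℝ := fun x => ∑ α, f (Function.update x a α) with hg
    have hg0 : ∀ x, 0 ≤ g x := fun x => sum_nonneg fun α _ => hf0 _
    have hgT : ∀ x y, (∀ t ∈ T, x t = y t) → g x = g y := fun x y hxy =>
      sum_congr rfl fun α _ => hfu α x y hxy
    obtain ⟨Z, m, hm, hgm⟩ := ih g hg0 hgT
    set n : X a → (∀ v, X v) → ℝ := fun α x =>
      if g x = 0 then (Fintype.card (X a) : ℝ)⁻¹ else f (Function.update x a α) / g x with hn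
    have hcard : (Fintype.card (X a) : ℝ) ≠ 0 := by exact_mod_cast Fintype.card_ne_zero
    have hfn : ∀ x, f x = g x * n (x a) x := by
      intro x
      by_cases h : g x = 0
      · have h1 := (sum_eq_zero_iff_of_nonneg fun α _ => hf0 _).1 h (x a) (mem_univ _)
        simpa [h] using h1
      · simp only [hn, if_neg h, Function.update_eq_self]
        field_simp
    refine ⟨Z, Function.update m a n, fun u hu => ?_, fun x => ?_⟩
    · by_cases h : u = a
      · subst h
        rw [Function.update_self]
        refine ⟨fun α x => ?_, fun α x y hxy => ?_, fun x => ?_⟩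
        · simp only [hn]
          split_ifs
          · positivity
          · exact div_nonneg (hf0 _) (hg0 _)
        · have hT : ∀ t ∈ T, x t = y t := fun t ht =>
            hxy t ⟨mem_insert_of_mem ht, by rintro rfl; exact ha ht, hmin t ht⟩
          simp only [hn, hgT x y hT, hfu α x y hT]
        · by_cases h : g x = 0
          · simp [hn, h, hcard]
          · simp only [hn, if_neg h, ← sum_div]
            exact div_self h
      · rw [Function.update_of_ne h]
        exact (hm u (mem_of_mem_insert_of_ne hu h)).mono fun t ht =>
          ⟨mem_insert_of_mem ht.1, ht.2⟩
    · rw [prod_insert ha, Function.update_self, hfn x, hgm x]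
      have : ∏ u ∈ T, Function.update m a n u (x u) x = ∏ u ∈ T, m u (x u) x :=
        prod_congr rfl fun u hu => by
          rw [Function.update_of_ne]
          rintro rfl
          exact ha hu
      rw [this]
      ring

/-- On a parent-closed set of nodes, a product of kernels along a DAG with complete parent and
child sets is, up to a constant, a product of kernels along the reversed graph. -/
theorem exists_reversed_kernels [Fintype V] [DecidableEq V] [∀ v, Nonempty (X v)]
    {E : V → V → Prop} {O : V → ℕ}
    (hO : ∀ s t, E s t → O s < O t)
    (hpa : ∀ s, GComplete E (paG E s)) (hch : ∀ s, GComplete E (chG E s))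
    {k : ∀ s, X s → (∀ v, X v) → ℝ} (hk : ∀ s, IsKernel X E s (k s)) (S : Finset V) :
    (∀ s ∈ S, ∀ t, E t s → t ∈ S) →
    ∃ (Z : ℝ) (l : ∀ s, X s → (∀ v, X v) → ℝ),
      (∀ s ∈ S, IsKernel X (fun t s => t ∈ S ∧ E s t) s (l s)) ∧
      ∀ x, ∏ s ∈ S, k s (x s) x = Z * ∏ s ∈ S, l s (x s) x := by
  classical
  induction S using Finset.induction_on_max_value O with
  | empty => exact fun _ => ⟨1, fun _ _ _ => 0, by simp, by simp⟩
  | insert r S hr hmax ih =>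
    intro hcl
    have hleaf : ∀ s ∈ S, ¬ E r s := fun s hs h => (hO _ _ h).not_ge (hmax s hs)
    obtain ⟨Z, l, hl, hkl⟩ := ih fun s hs t ht =>
      mem_of_mem_insert_of_ne (hcl s (mem_insert_of_mem hs) t ht)
        (by rintro rfl; exact hleaf s hs ht)
    set C : Finset V := {u ∈ S | E u r} with hC
    have hCS : C ⊆ S := filter_subset _ _
    have hCE : ∀ u ∈ C, E u r := fun u hu => (mem_filter.1 hu).2
    have hpaC : ∀ t, E t r → t ∈ C := fun t ht =>
      mem_filter.2 ⟨mem_of_mem_insert_of_ne (hcl r (mem_insert_self _ _) t ht)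
        (by rintro rfl; exact lt_irrefl _ (hO _ _ ht)), ht⟩
    have hchC : ∀ u ∈ C, ∀ t ∈ S, E u t → t ∈ C := by
      intro u hu t ht hut
      have hne : t ≠ r := by rintro rfl; exact hr ht
      rcases hch u t hut r (hCE u hu) hne with h | h
      · exact hpaC t h
      · exact absurd h (hleaf t ht)
    obtain ⟨Z', m, hm, hfm⟩ := exists_chain_rule (X := X) O (insert r C)
      (fun x => k r (x r) x * ∏ u ∈ C, l u (x u) x)
      (fun x => mul_nonneg ((hk r).1 _ _) (prod_nonneg fun u hu => (hl u (hCS hu)).1 _ _))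
      (fun x y hxy => by
        have hxyC : ∀ t ∈ C, x t = y t := fun t ht => hxy t (mem_insert_of_mem ht)
        rw [hxy r (mem_insert_self _ _), (hk r).2.1 _ x y fun t ht => hxyC t (hpaC t ht)]
        congr 1
        refine prod_congr rfl fun u hu => ?_
        rw [hxyC u hu]
        exact (hl u (hCS hu)).2.1 _ x y fun t ht => hxyC t (hchC u hu t ht.1 ht.2))
    have hjoin : ∀ u ∈ insert r C, ∀ t ∈ insert r C, t ≠ u → O u ≤ O t → E u t := by
      intro u hu t ht hne hle
      have hj : E u t ∨ E t u := by
        rcases mem_insert.1 hu with rfl | hu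
        · exact .inr (hCE t (mem_of_mem_insert_of_ne ht hne))
        · rcases mem_insert.1 ht with rfl | ht
          · exact .inl (hCE u hu)
          · exact hpa r u (hCE u hu) t (hCE t ht) hne.symm
      exact hj.resolve_right fun h => (hO _ _ h).not_ge hle
    refine ⟨Z * Z', fun u => if u ∈ insert r C then m u else l u, fun u hu => ?_, fun x => ?_⟩
    · by_cases h : u ∈ insert r C
      · simp only [if_pos h]
        exact (hm u h).mono fun t ht =>
          ⟨insert_subset_insert _ hCS ht.1, hjoin u h t ht.1 ht.2.1 ht.2.2⟩
      · simp only [if_neg h]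
        have hur : u ≠ r := by rintro rfl; exact h (mem_insert_self _ _)
        exact (hl u (mem_of_mem_insert_of_ne hu hur)).mono fun t ht =>
          ⟨mem_insert_of_mem ht.1, ht.2⟩
    · have hsd : insert r S \ insert r C = S \ C := by
        ext u
        simp only [mem_sdiff, mem_insert]
        constructor
        · tauto
        · rintro ⟨h1, h2⟩
          refine ⟨.inr h1, ?_⟩
          rintro (rfl | h)
          · exact hr h1
          · exact h2 h
      have h1 : ∏ u ∈ insert r C, (if u ∈ insert r C then m u else l u) (x u) x =
          ∏ u ∈ insert r C, m u (x u) x := prod_congr rfl fun u hu => by rw [if_pos hu]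
      have h2 : ∏ u ∈ S \ C, (if u ∈ insert r C then m u else l u) (x u) x =
          ∏ u ∈ S \ C, l u (x u) x := prod_congr rfl fun u hu => by
        rw [← hsd] at hu
        rw [if_neg (mem_sdiff.1 hu).2]
      have h3 := hfm x
      rw [prod_insert hr, hkl x, ← prod_sdiff hCS, ← prod_sdiff (insert_subset_insert r hCS), hsd]
      beta_reduce
      rw [h1, h2]
      linear_combination (Z * ∏ u ∈ S \ C, l u (x u) x) * h3

theorem Factorizes.reverse [Fintype V] [DecidableEq V] [∀ v, Nonempty (X v)]
    {E : V → V → Prop} (hE : IsDAG E)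
    (hpa : ∀ s, GComplete E (paG E s)) (hch : ∀ s, GComplete E (chG E s))
    {p : (∀ v, X v) → ℝ} (hp : IsPMF X p) (h : Factorizes X E p) :
    Factorizes X (fun a b => E b a) p := by
  obtain ⟨k, hk, hpk⟩ := h
  obtain ⟨O, hO⟩ := exists_strictMono_height hE
  obtain ⟨Z, l, hl, hkl⟩ := exists_reversed_kernels hO hpa hch hk univ (by simp)
  have hl' : ∀ s, IsKernel X (fun a b => E b a) s (l s) := fun s =>
    (hl s (mem_univ _)).mono fun t ht => ht.2
  have hZ : Z = 1 := by
    have h1 := hp.2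
    rwa [sum_congr rfl fun x _ => (hpk x).trans (hkl x), ← mul_sum,
      sum_prod_kernel_eq_one hE.reverse hl', mul_one] at h1
  exact ⟨l, hl', fun x => by rw [hpk, hkl, hZ, one_mul]⟩

/-- A configuration with positive kernels up to some height extends to one with positive
kernels everywhere. -/
theorem exists_pos_extension [Fintype V] {E : V → V → Prop} {O : V → ℕ}
    (hO : ∀ s t, E s t → O s < O t) {k : ∀ s, X s → (∀ v, X v) → ℝ}
    (hk : ∀ s, IsKernel X E s (k s)) (n : ℕ) (x : ∀ v, X v)
    (hx : ∀ v, O v ≤ n → 0 < k v (x v) x) :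
    ∃ y : ∀ v, X v, (∀ v, O v ≤ n → y v = x v) ∧ ∀ v, 0 < k v (y v) y := by
  have hpos : ∀ v (z : ∀ v, X v), ∃ a, 0 < k v a z := by
    intro v z
    by_contra! h
    have h1 := (hk v).2.2 z
    have h2 : ∑ a, k v a z ≤ 0 := sum_nonpos fun a _ => h a
    linarith
  have key : ∀ j, ∃ y : ∀ v, X v, (∀ v, O v ≤ n → y v = x v) ∧
      ∀ v, O v ≤ n + j → 0 < k v (y v) y := by
    intro j
    induction j with
    | zero => exact ⟨x, fun _ _ => rfl, hx⟩
    | succ j ih =>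
      obtain ⟨y, hyx, hy⟩ := ih
      choose c hc using fun v => hpos v y
      refine ⟨fun v => if O v ≤ n + j then y v else c v, fun v hv => ?_, fun v hv => ?_⟩
      · exact (if_pos (by omega)).trans (hyx v hv)
      · rw [(hk v).2.1 _ _ y fun t ht => if_pos (by have := hO _ _ ht; omega)]
        by_cases h : O v ≤ n + j
        · simpa only [if_pos h] using hy v h
        · simpa only [if_neg h] using hc v
  obtain ⟨y, hyx, hy⟩ := key (univ.sup O)
  exact ⟨y, hyx, fun v => hy v ((le_sup (mem_univ v)).trans (Nat.le_add_left _ _))⟩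

theorem joined_of_common_child [Fintype V] [DecidableEq V] (h2 : ∀ v, 1 < Fintype.card (X v))
    {E : V → V → Prop}
    (hE : IsDAG E) {O : V → ℕ} (hO : ∀ s t, E t s → O s < O t)
    (h : ∀ p : (∀ v, X v) → ℝ, IsPMF X p → Factorizes X E p →
      Factorizes X (fun a b => E b a) p)
    {a b s : V} (has : E a s) (hbs : E b s) (hab : a ≠ b) (hle : O a ≤ O b) :
    GJoined E a b := by
  classical
  by_contra hj
  have : ∀ v, Nonempty (X v) := fun v => Fintype.card_pos_iff.1 (by have := h2 v; omega)
  choose c0 c1 hc using fun v => Fintype.one_lt_card_iff.1 (h2 v)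
  have hsa : s ≠ a := by rintro rfl; exact lt_irrefl _ (hO _ _ has)
  have hsb : s ≠ b := by rintro rfl; exact lt_irrefl _ (hO _ _ hbs)
  let F : ∀ v, (∀ v, X v) → X v := fun v x =>
    if v = s ∧ ¬ (x a = c0 a ↔ x b = c0 b) then c1 v else c0 v
  let k : ∀ v, X v → (∀ v, X v) → ℝ := fun v α x =>
    if v = a ∨ v = b then (Fintype.card (X v) : ℝ)⁻¹ else if α = F v x then 1 else 0
  have hcard : ∀ v, (0 : ℝ) < (Fintype.card (X v) : ℝ)⁻¹ := fun v =>
    inv_pos.2 (by exact_mod_cast Fintype.card_pos)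
  have hk : ∀ v, IsKernel X E v (k v) := by
    intro v
    refine ⟨fun α x => ?_, fun α x y hxy => ?_, fun x => ?_⟩
    · simp only [k]
      split_ifs
      exacts [(hcard v).le, zero_le_one, le_rfl]
    · have hF : F v x = F v y := by
        by_cases hv : v = s
        · subst hv
          simp only [F, hxy a has, hxy b hbs]
        · simp [F, hv]
      simp only [k, hF]
    · by_cases hv : v = a ∨ v = b
      · simp [k, hv]
      · simp [k, hv]
  have hp : IsPMF X fun x => ∏ v, k v (x v) x :=
    ⟨fun x => prod_nonneg fun v _ => (hk v).1 _ _, sum_prod_kernel_eq_one hE hk⟩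
  obtain ⟨l, hl, hkl⟩ := h _ hp ⟨k, hk, fun _ => rfl⟩
  simp only at hkl
  have hlpos : ∀ x : ∀ v, X v, (∀ v, v ≠ a → v ≠ b → x v = F v x) → ∀ v, 0 < l v (x v) x := by
    intro x hx v
    have h1 : 0 < ∏ v, k v (x v) x := prod_pos fun v _ => by
      simp only [k]
      split_ifs with h3 h4
      · exact hcard v
      · exact one_pos
      · push Not at h3
        exact absurd (hx v h3.1 h3.2) h4
    rw [hkl x] at h1
    exact ((hl v).1 _ _).lt_of_ne' fun h0 => h1.ne' (prod_eq_zero (mem_univ v) h0)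
  have hx1 := hlpos c0 fun v _ _ => by simp [F]
  let x2 : ∀ v, X v := Function.update (Function.update c0 a (c1 a)) b (c1 b)
  have hx2 := hlpos x2 fun v hva hvb => by
    have e1 : x2 a = c1 a := by simp [x2, hab]
    have e2 : x2 b = c1 b := by simp [x2]
    have e3 : x2 v = c0 v := by simp [x2, hva, hvb]
    simp [F, e1, e2, e3, (hc a).symm, (hc b).symm]
  obtain ⟨y, hyx, hy⟩ := exists_pos_extension (E := fun a b => E b a)
    hO hl (O b) (Function.update c0 b (c1 b)) fun v hv => by
      by_cases hvb : v = b
      · subst hvb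
        have h1 := hx2 v
        rw [(hl v).2.1 _ x2 (Function.update c0 v (c1 v)) fun t ht => ?_] at h1
        · simpa [x2] using h1
        · have hta : t ≠ a := by rintro rfl; exact hj (.inr ht)
          have htv : t ≠ v := by rintro rfl; exact lt_irrefl _ (hO _ _ ht)
          simp [x2, hta, htv]
      · rw [(hl v).2.1 _ _ c0 fun t ht => ?_, Function.update_of_ne hvb]
        · exact hx1 v
        · have htb : t ≠ b := by
            intro h
            rw [h] at ht
            exact (hO _ _ ht).not_ge hv
          simp [htb]
  have hya : y a = c0 a := by rw [hyx a hle, Function.update_of_ne hab]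
  have hyb : y b = c1 b := by rw [hyx b le_rfl, Function.update_self]
  have hys : y s = c0 s := by rw [hyx s (hO _ _ hbs).le, Function.update_of_ne hsb]
  have h1 : 0 < ∏ v, k v (y v) y := by
    rw [hkl y]
    exact prod_pos fun v _ => hy v
  have h0 : k s (y s) y = 0 := by
    simp [k, F, hsa, hsb, hya, hyb, hys, (hc b).symm, hc s]
  exact h1.ne' (prod_eq_zero (mem_univ s) h0)

theorem gComplete_paG_of_factorizes [Fintype V] [DecidableEq V] (h2 : ∀ v, 1 < Fintype.card (X v))
    {E : V → V → Prop}
    (hE : IsDAG E) (h : ∀ p : (∀ v, X v) → ℝ, IsPMF X p → Factorizes X E p →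
      Factorizes X (fun a b => E b a) p) (s : V) : GComplete E (paG E s) := by
  obtain ⟨O, hO⟩ := exists_strictMono_height hE.reverse
  intro a ha b hb hab
  rcases le_total (O a) (O b) with hle | hle
  · exact joined_of_common_child h2 hE hO h ha hb hab hle
  · exact (joined_of_common_child h2 hE hO h hb ha hab.symm hle).symm

end Kernels

/-- `P^G = P^{G*}` iff `pa_G(s)` and `ch_G(s)` are complete for every `s`. -/
theorem stmt16 {V : Type*} [Fintype V] [DecidableEq V] [Nonempty V]
    (X : V → Type*) [∀ v, Fintype (X v)] (h2 : ∀ v, 1 < Fintype.card (X v))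
    (E : V → V → Prop) (hE : IsDAG E) :
    (∀ p : (∀ v, X v) → ℝ, IsPMF X p →
      (Factorizes X E p ↔ Factorizes X (fun a b => E b a) p)) ↔
    (∀ s, GComplete E (paG E s) ∧ GComplete E (chG E s)) := by
  constructor
  · intro h s
    exact ⟨gComplete_paG_of_factorizes h2 hE (fun p hp => (h p hp).1) s,
      fun a ha b hb hab =>
        (gComplete_paG_of_factorizes h2 hE.reverse (fun p hp => (h p hp).2) s a ha b hb hab).symm⟩
  · intro h p hp
    have : ∀ v, Nonempty (X v) := fun v => Fintype.card_pos_iff.1 (by have := h2 v; omega)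
    exact ⟨fun hf => hf.reverse hE (fun s => (h s).1) (fun s => (h s).2) hp,
      fun hf => hf.reverse hE.reverse (fun s a ha b hb hab => ((h s).2 a ha b hb hab).symm)
        (fun s a ha b hb hab => ((h s).1 a ha b hb hab).symm) hp⟩
end
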